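/- Uniform ergodicity of the actor chain along the algorithm trajectory: for any fixed T > 0 there exist an integer n₀ ≥ 1 and constants C > 0, ε_T > 0, β_T ∈ (0,1) such that, for all N ∈ ℕ and all parameter iterates {θ_k}_{0≤k≤NT} produced by the actor-critic algorithm: (i) inf_{k≤NT} σ_μ^{f_{θ_k}}(x,a) ≥ C ε_T^{n₀} for every (x,a) ∈ 𝒳×𝒜, and (ii) sup_{k≤NT} ‖Π^n_{θ_k}(ξ;·) − σ_μ^{f_{θ_k}}(·)‖ ≤ (1−β_T)^{⌊n/n₀⌋} for every ξ ∈ 𝒳×𝒜 and n ∈ ℕ, where Π^n_{θ_k} is the n-step transition matrix. -/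

import Mathlib

open MeasureTheory Filter Set
open scoped Classical

noncomputable section

def softmaxPol {X A : Type*} [Fintype A] (θ : X → A → ℝ) (x : X) (a : A) : ℝ :=
  Real.exp (θ x a) / ∑ a', Real.exp (θ x a')

def explorePol {X A : Type*} [Fintype A] (η : ℝ) (θ : X → A → ℝ) (x : X) (a : A) : ℝ :=
  η / (Fintype.card A : ℝ) + (1 - η) * softmaxPol θ x a

def zetaN (N k : ℕ) : ℝ := (1 + (k : ℝ) / (N : ℝ))⁻¹

def etaN (N k : ℕ) : ℝ := (1 + (Real.log ((k : ℝ) / (N : ℝ) + 1)) ^ 2)⁻¹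

def zetaT (t : ℝ) : ℝ := (1 + t)⁻¹

def etaT (t : ℝ) : ℝ := (1 + (Real.log (t + 1)) ^ 2)⁻¹

def IsPolicy {X A : Type*} [Fintype A] (f : X → A → ℝ) : Prop :=
  (∀ x a, 0 ≤ f x a) ∧ ∀ x, ∑ a, f x a = 1

def ptilde {X A : Type*} (γ : ℝ) (p : X → A → X → ℝ) (μ : X → ℝ)
    (x : X) (a : A) (x' : X) : ℝ :=
  γ * p x a x' + (1 - γ) * μ x'

def actorKer {X A : Type*} (γ : ℝ) (p : X → A → X → ℝ) (μ : X → ℝ) (f : X → A → ℝ) :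
    X × A → X × A → ℝ :=
  fun ξ ξ' => ptilde γ p μ ξ.1 ξ.2 ξ'.1 * f ξ'.1 ξ'.2

def criticKer {X A : Type*} (p : X → A → X → ℝ) (g : X → A → ℝ) :
    X × A → X × A → ℝ :=
  fun ξ ξ' => p ξ.1 ξ.2 ξ'.1 * g ξ'.1 ξ'.2

def kpow {S : Type*} [Fintype S] [DecidableEq S] (K : S → S → ℝ) : ℕ → S → S → ℝ
  | 0 => fun ξ ξ' => if ξ = ξ' then 1 else 0
  | n + 1 => fun ξ ξ' => ∑ y, K ξ y * kpow K n y ξ'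

def IsStationaryDist {S : Type*} [Fintype S] (K : S → S → ℝ) (d : S → ℝ) : Prop :=
  (∀ ξ, 0 ≤ d ξ) ∧ (∑ ξ, d ξ = 1) ∧ ∀ ξ', d ξ' = ∑ ξ, d ξ * K ξ ξ'

def pathSum {X A : Type*} [Fintype X] [Fintype A] [DecidableEq X]
    (p : X → A → X → ℝ) : ℕ → X → A → X → ℝ
  | 0 => fun x _ x' => if x = x' then 1 else 0
  | 1 => fun x a x' => p x a x'
  | n + 2 => fun x a x' => ∑ x₁ : X, ∑ a₁ : A, p x a x₁ * pathSum p (n + 1) x₁ a₁ x'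

section Softmax

variable {X A : Type*} [Fintype A]

lemma IsPolicy.le_one {f : X → A → ℝ} (hf : IsPolicy f) (x : X) (a : A) : f x a ≤ 1 := by
  rw [← hf.2 x]
  exact Finset.single_le_sum (fun b _ => hf.1 x b) (Finset.mem_univ a)

lemma IsPolicy.abs_sum_mul_le {f : X → A → ℝ} (hf : IsPolicy f) (x : X) {v : A → ℝ} {M : ℝ}
    (hv : ∀ a, |v a| ≤ M) : |∑ a, v a * f x a| ≤ M := by
  calc |∑ a, v a * f x a| ≤ ∑ a, |v a * f x a| := Finset.abs_sum_le_sum_abs _ _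
    _ ≤ ∑ a, M * f x a := Finset.sum_le_sum fun a _ => by
        rw [abs_mul, abs_of_nonneg (hf.1 x a)]
        exact mul_le_mul_of_nonneg_right (hv a) (hf.1 x a)
    _ = M := by rw [← Finset.mul_sum, hf.2 x, mul_one]

variable [Nonempty A]

lemma sum_exp_pos (v : A → ℝ) : 0 < ∑ a, Real.exp (v a) :=
  Finset.sum_pos (fun _ _ => Real.exp_pos _) Finset.univ_nonempty

lemma isPolicy_softmaxPol (θ : X → A → ℝ) : IsPolicy (softmaxPol θ) := by
  refine ⟨fun x a => div_nonneg (Real.exp_pos _).le (sum_exp_pos (θ x)).le, fun x => ?_⟩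
  simp only [softmaxPol]
  rw [← Finset.sum_div, div_self (sum_exp_pos (θ x)).ne']

lemma isPolicy_explorePol {η : ℝ} (hη0 : 0 ≤ η) (hη1 : η ≤ 1) (θ : X → A → ℝ) :
    IsPolicy (explorePol η θ) := by
  have hs := isPolicy_softmaxPol θ
  refine ⟨fun x a => add_nonneg (by positivity)
    (mul_nonneg (by linarith) (hs.1 x a)), fun x => ?_⟩
  have hA : (Fintype.card A : ℝ) ≠ 0 := by exact_mod_cast Fintype.card_ne_zero
  simp only [explorePol]
  rw [Finset.sum_add_distrib, ← Finset.mul_sum, hs.2 x, Finset.sum_const, Finset.card_univ,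
    nsmul_eq_mul]
  field_simp
  ring

/-- Bounded parameters give a softmax policy comparable with the uniform one. -/
lemma exp_mul_softmaxPol_zero_le {θ : X → A → ℝ} {R : ℝ} (hθ : ∀ x a, |θ x a| ≤ R)
    (x : X) (a : A) :
    Real.exp (-(2 * R)) * softmaxPol (0 : X → A → ℝ) x a ≤ softmaxPol θ x a := by
  have hA : (0 : ℝ) < Fintype.card A := by exact_mod_cast Fintype.card_pos
  have hsum : ∑ a', Real.exp (θ x a') ≤ Fintype.card A * Real.exp R := by
    calc ∑ a', Real.exp (θ x a') ≤ ∑ _a' : A, Real.exp R :=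
          Finset.sum_le_sum fun b _ => Real.exp_le_exp.2 (le_of_abs_le (hθ x b))
      _ = Fintype.card A * Real.exp R := by simp
  have hnum : Real.exp (-R) ≤ Real.exp (θ x a) :=
    Real.exp_le_exp.2 (neg_le_of_abs_le (hθ x a))
  calc Real.exp (-(2 * R)) * softmaxPol (0 : X → A → ℝ) x a
      = Real.exp (-R) / (Fintype.card A * Real.exp R) := by
        have h2 : Real.exp (-(2 * R)) = Real.exp (-R) / Real.exp R := by
          rw [← Real.exp_sub]; congr 1; ring
        simp only [softmaxPol, h2, Pi.zero_apply, Real.exp_zero, Finset.sum_const,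
          Finset.card_univ, nsmul_eq_mul, mul_one]
        field_simp
    _ ≤ softmaxPol θ x a :=
        div_le_div₀ (Real.exp_pos _).le hnum (sum_exp_pos (θ x)) hsum

end Softmax

lemma zetaN_nonneg (N k : ℕ) : 0 ≤ zetaN N k := by
  unfold zetaN; positivity

lemma zetaN_le_one (N k : ℕ) : zetaN N k ≤ 1 :=
  inv_le_one_of_one_le₀ (le_add_of_nonneg_right (by positivity))

lemma etaN_nonneg (N k : ℕ) : 0 ≤ etaN N k := by
  unfold etaN; positivity

lemma etaN_le_one (N k : ℕ) : etaN N k ≤ 1 :=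
  inv_le_one_of_one_le₀ (le_add_of_nonneg_right (by positivity))

section Iterates

variable {X A : Type*} [Fintype A] [Nonempty A] [DecidableEq X] [DecidableEq A]

lemma critic_add_one_le {r : X → A → ℝ} {γ α : ℝ}
    (hr : ∀ x a, 0 ≤ r x a ∧ r x a ≤ 1) (hγ : 0 < γ ∧ γ < 1) (hα : 0 < α)
    {N : ℕ} (hN : 0 < N) {xc : ℕ → X} {ac : ℕ → A} {Q θ : ℕ → X → A → ℝ}
    (hQ : ∀ k x a, Q (k + 1) x a = Q k x a + (α / N) *
      (r (xc k) (ac k) + γ * (∑ a'', Q k (xc (k + 1)) a'' *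
          explorePol (etaN N k) (θ k) (xc (k + 1)) a'') - Q k (xc k) (ac k)) *
      (if xc k = x ∧ ac k = a then 1 else 0))
    {B : ℝ} (hB : ∀ x a, |Q 0 x a| ≤ B) (k : ℕ) :
    ∀ x a, |Q k x a| + 1 ≤ (B + 1) * Real.exp (2 * α * (k / N)) := by
  have hN' : (0 : ℝ) < N := by exact_mod_cast hN
  induction k with
  | zero => intro x a; simpa using hB x a
  | succ k ih =>
    intro x a
    set M := (B + 1) * Real.exp (2 * α * (k / N)) with hM
    have hM1 : 1 ≤ M := le_trans (le_add_of_nonneg_left (abs_nonneg _)) (ih x a)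
    have hS := (isPolicy_explorePol (etaN_nonneg N k) (etaN_le_one N k) (θ k)).abs_sum_mul_le
      (xc (k + 1)) (v := Q k (xc (k + 1))) (M := M - 1) (fun b => by linarith [ih (xc (k + 1)) b])
    set S := ∑ a'', Q k (xc (k + 1)) a'' * explorePol (etaN N k) (θ k) (xc (k + 1)) a''
    have hδ : |r (xc k) (ac k) + γ * S - Q k (xc k) (ac k)| ≤ 2 * M := by
      have h1 : |γ * S| ≤ M - 1 := by
        rw [abs_mul, abs_of_pos hγ.1]
        nlinarith [abs_nonneg S, hγ.1, hγ.2]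
      have h2 := ih (xc k) (ac k)
      obtain ⟨h3, h4⟩ := hr (xc k) (ac k)
      rw [abs_le] at h1 ⊢
      have h5 := abs_le.1 (le_sub_iff_add_le.2 h2)
      constructor <;> linarith [h1.1, h1.2, h5.1, h5.2]
    have hstep : |Q (k + 1) x a| ≤ |Q k x a| + α / N * (2 * M) := by
      rw [hQ]
      refine (abs_add_le _ _).trans (add_le_add_right ?_ _)
      rw [abs_mul, abs_mul, abs_of_pos (div_pos hα hN')]
      have hi : |(if xc k = x ∧ ac k = a then (1 : ℝ) else 0)| ≤ 1 := by split_ifs <;> simp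
      have := mul_le_mul_of_nonneg_left hδ (div_pos hα hN').le
      exact (mul_le_of_le_one_right (by positivity) hi).trans this
    have hexp : (B + 1) * Real.exp (2 * α * (((k + 1 : ℕ) : ℝ) / N))
        = M * Real.exp (2 * (α / N)) := by
      rw [hM, mul_assoc (B + 1), ← Real.exp_add]
      congr 2
      push_cast
      ring
    rw [hexp]
    have := Real.add_one_le_exp (2 * (α / N))
    nlinarith [ih x a]

lemma actor_abs_le {N : ℕ} (hN : 0 < N) {xa : ℕ → X} {aa : ℕ → A} {Q θ : ℕ → X → A → ℝ}
    (hθ : ∀ k x a, θ (k + 1) x a = θ k x a + (zetaN N k / N) *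
      Q k (xa k) (aa k) * (if xa k = x then 1 else 0) *
      ((if aa k = a then 1 else 0) - softmaxPol (θ k) (xa k) a))
    {B D : ℝ} (hB : ∀ x a, |θ 0 x a| ≤ B) {n : ℕ} (hD : ∀ k ≤ n, ∀ x a, |Q k x a| ≤ D)
    (k : ℕ) (hk : k ≤ n) : ∀ x a, |θ k x a| ≤ B + D * (k / N) := by
  have hN' : (0 : ℝ) < N := by exact_mod_cast hN
  induction k with
  | zero => intro x a; simpa using hB x a
  | succ k ih =>
    intro x a
    have hk' : k ≤ n := (Nat.le_succ k).trans hk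
    have hQk := hD k hk' (xa k) (aa k)
    have hD0 : 0 ≤ D := (abs_nonneg _).trans hQk
    have hs := isPolicy_softmaxPol (θ k)
    have hi : |(if xa k = x then (1 : ℝ) else 0)| ≤ 1 := by split_ifs <;> simp
    have hj : |(if aa k = a then (1 : ℝ) else 0) - softmaxPol (θ k) (xa k) a| ≤ 1 := by
      have h0 := hs.1 (xa k) a
      have h1 := hs.le_one (xa k) a
      rw [abs_le]
      split_ifs <;> constructor <;> linarith
    have hz : |zetaN N k / N| ≤ 1 / N := by
      rw [abs_of_nonneg (div_nonneg (zetaN_nonneg N k) hN'.le)]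
      exact div_le_div_of_nonneg_right (zetaN_le_one N k) hN'.le
    have hstep : |θ (k + 1) x a| ≤ |θ k x a| + 1 / N * D * 1 * 1 := by
      rw [hθ]
      refine (abs_add_le _ _).trans (add_le_add_right ?_ _)
      rw [abs_mul, abs_mul, abs_mul]
      gcongr
    calc |θ (k + 1) x a| ≤ _ := hstep
      _ ≤ B + D * (k / N) + 1 / N * D * 1 * 1 := add_le_add_left (ih hk' x a) _
      _ = B + D * ((k + 1 : ℕ) / N) := by push_cast; ring

end Iterates

section Kernel

variable {S : Type*} [Fintype S] [DecidableEq S]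

lemma kpow_add (K : S → S → ℝ) (m n : ℕ) (ξ ξ' : S) :
    kpow K (m + n) ξ ξ' = ∑ y, kpow K m ξ y * kpow K n y ξ' := by
  have hpow : ∀ (j : ℕ) (a b : S), kpow K j a b = (Matrix.of K ^ j) a b := by
    intro j
    induction j with
    | zero => intro a b; simp [kpow, Matrix.one_apply]
    | succ j ih => intro a b; simp [kpow, pow_succ', Matrix.mul_apply, ih]
  simp only [hpow, pow_add, Matrix.mul_apply]

lemma kpow_nonneg {K : S → S → ℝ} (hK : ∀ ξ ξ', 0 ≤ K ξ ξ') (n : ℕ) :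
    ∀ ξ ξ', 0 ≤ kpow K n ξ ξ' := by
  induction n with
  | zero => intro ξ ξ'; simp only [kpow]; split_ifs <;> norm_num
  | succ n ih => exact fun ξ ξ' => Finset.sum_nonneg fun y _ => mul_nonneg (hK ξ y) (ih y ξ')

lemma kpow_sum {K : S → S → ℝ} (hK : ∀ ξ, ∑ ξ', K ξ ξ' = 1) (n : ℕ) :
    ∀ ξ, ∑ ξ', kpow K n ξ ξ' = 1 := by
  induction n with
  | zero => intro ξ; simp [kpow]
  | succ n ih =>
    intro ξ
    simp only [kpow]
    rw [Finset.sum_comm]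
    simp only [← Finset.mul_sum, ih, mul_one, hK]

lemma pow_mul_kpow_le {K L : S → S → ℝ} {c : ℝ} (hc : 0 ≤ c) (hL : ∀ ξ ξ', 0 ≤ L ξ ξ')
    (hLK : ∀ ξ ξ', c * L ξ ξ' ≤ K ξ ξ') (n : ℕ) :
    ∀ ξ ξ', c ^ n * kpow L n ξ ξ' ≤ kpow K n ξ ξ' := by
  induction n with
  | zero => intro ξ ξ'; simp [kpow]
  | succ n ih =>
    intro ξ ξ'
    simp only [kpow]
    rw [Finset.mul_sum]
    refine Finset.sum_le_sum fun y _ => ?_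
    calc c ^ (n + 1) * (L ξ y * kpow L n y ξ') = (c * L ξ y) * (c ^ n * kpow L n y ξ') := by ring
      _ ≤ K ξ y * kpow K n y ξ' :=
        mul_le_mul (hLK ξ y) (ih y ξ')
          (mul_nonneg (pow_nonneg hc n) (kpow_nonneg hL n y ξ'))
          ((mul_nonneg hc (hL ξ y)).trans (hLK ξ y))

lemma IsStationaryDist.sum_mul_kpow {K : S → S → ℝ} {d : S → ℝ} (hd : IsStationaryDist K d)
    (n : ℕ) : ∀ ξ', ∑ ξ, d ξ * kpow K n ξ ξ' = d ξ' := by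
  induction n with
  | zero => intro ξ'; simp [kpow]
  | succ n ih =>
    intro ξ'
    calc ∑ ξ, d ξ * kpow K (n + 1) ξ ξ'
        = ∑ y, (∑ ξ, d ξ * K ξ y) * kpow K n y ξ' := by
          simp only [kpow, Finset.mul_sum, Finset.sum_mul]
          rw [Finset.sum_comm]
          simp only [mul_assoc]
      _ = d ξ' := by simp only [← hd.2.2, ih]

lemma IsStationaryDist.le_of_le_kpow {K : S → S → ℝ} {d : S → ℝ} (hd : IsStationaryDist K d)
    {n : ℕ} {δ : ℝ} (hδ : ∀ ξ ξ', δ ≤ kpow K n ξ ξ') (ξ' : S) : δ ≤ d ξ' := by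
  rw [← hd.sum_mul_kpow n ξ']
  calc δ = ∑ ξ, d ξ * δ := by rw [← Finset.sum_mul, hd.2.1, one_mul]
    _ ≤ _ := Finset.sum_le_sum fun ξ _ => mul_le_mul_of_nonneg_left (hδ ξ ξ') (hd.1 ξ)

/-- **Doeblin's theorem**: a minorized finite chain converges geometrically in total variation. -/
lemma IsStationaryDist.tv_kpow_le {K : S → S → ℝ} {d : S → ℝ} (hd : IsStationaryDist K d)
    (hK0 : ∀ ξ ξ', 0 ≤ K ξ ξ') (hK1 : ∀ ξ, ∑ ξ', K ξ ξ' = 1) {m : ℕ} {β : ℝ}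
    (hβ : ∀ ξ ξ', β * d ξ' ≤ kpow K m ξ ξ') (ξ : S) (n : ℕ) :
    (1 / 2) * ∑ ξ', |kpow K n ξ ξ' - d ξ'| ≤ (1 - β) ^ (n / m) := by
  have key : ∀ (q s : ℕ) (ξ : S),
      (1 / 2) * ∑ ξ', |kpow K (m * q + s) ξ ξ' - d ξ'| ≤ (1 - β) ^ q := by
    intro q s
    induction q with
    | zero =>
      intro ξ
      have h : ∑ ξ', |kpow K (m * 0 + s) ξ ξ' - d ξ'| ≤ 2 := by
        calc ∑ ξ', |kpow K (m * 0 + s) ξ ξ' - d ξ'|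
            ≤ ∑ ξ', (kpow K (m * 0 + s) ξ ξ' + d ξ') := Finset.sum_le_sum fun y _ => by
              have h0 := kpow_nonneg hK0 (m * 0 + s) ξ y
              have h1 := hd.1 y
              rw [abs_le]; constructor <;> linarith
          _ = 2 := by
              rw [Finset.sum_add_distrib, kpow_sum hK1, hd.2.1]; norm_num
      rw [pow_zero]
      linarith
    | succ q ih =>
      intro ξ
      have hdecomp : ∀ ξ', kpow K (m * (q + 1) + s) ξ ξ' - d ξ' =
          ∑ y, (kpow K m ξ y - β * d y) * (kpow K (m * q + s) y ξ' - d ξ') := by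
        intro ξ'
        rw [show m * (q + 1) + s = m + (m * q + s) by ring, kpow_add]
        simp only [sub_mul, mul_sub, Finset.sum_sub_distrib, mul_assoc, ← Finset.mul_sum,
          ← Finset.sum_mul, hd.sum_mul_kpow, kpow_sum hK1, hd.2.1]
        ring
      calc (1 / 2) * ∑ ξ', |kpow K (m * (q + 1) + s) ξ ξ' - d ξ'|
          ≤ (1 / 2) * ∑ ξ', ∑ y, (kpow K m ξ y - β * d y) *
              |kpow K (m * q + s) y ξ' - d ξ'| := by
            refine mul_le_mul_of_nonneg_left (Finset.sum_le_sum fun ξ' _ => ?_) (by norm_num)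
            rw [hdecomp]
            refine (Finset.abs_sum_le_sum_abs _ _).trans (Finset.sum_le_sum fun y _ => ?_)
            rw [abs_mul, abs_of_nonneg (sub_nonneg.2 (hβ ξ y))]
        _ = ∑ y, (kpow K m ξ y - β * d y) *
              ((1 / 2) * ∑ ξ', |kpow K (m * q + s) y ξ' - d ξ'|) := by
            rw [Finset.sum_comm, Finset.mul_sum]
            refine Finset.sum_congr rfl fun y _ => ?_
            rw [← Finset.mul_sum]; ring
        _ ≤ ∑ y, (kpow K m ξ y - β * d y) * (1 - β) ^ q :=
            Finset.sum_le_sum fun y _ => mul_le_mul_of_nonneg_left (ih y) (sub_nonneg.2 (hβ ξ y))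
        _ = (1 - β) ^ (q + 1) := by
            rw [← Finset.sum_mul, Finset.sum_sub_distrib, ← Finset.mul_sum, kpow_sum hK1,
              hd.2.1, mul_one, pow_succ']
  simpa only [Nat.div_add_mod] using key (n / m) (n % m) ξ

end Kernel

section ActorKernel

variable {X A : Type*} {γ : ℝ} {p : X → A → X → ℝ} {μ : X → ℝ}

lemma ptilde_nonneg (hp0 : ∀ x a x', 0 ≤ p x a x') (hμ0 : ∀ x, 0 ≤ μ x) (hγ : 0 < γ ∧ γ < 1)
    (x : X) (a : A) (x' : X) : 0 ≤ ptilde γ p μ x a x' :=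
  add_nonneg (mul_nonneg hγ.1.le (hp0 x a x')) (mul_nonneg (sub_nonneg.2 hγ.2.le) (hμ0 x'))

lemma actorKer_sum [Fintype X] [Fintype A] (hp1 : ∀ x a, ∑ x', p x a x' = 1)
    (hμ1 : ∑ x, μ x = 1) {f : X → A → ℝ} (hf : IsPolicy f) (ξ : X × A) :
    ∑ ξ', actorKer γ p μ f ξ ξ' = 1 := by
  simp only [actorKer, Fintype.sum_prod_type, ← Finset.mul_sum, hf.2, mul_one, ptilde,
    Finset.sum_add_distrib, hp1, hμ1]
  ring

end ActorKernel

lemma exists_abs_le {X A : Type*} [Finite X] [Finite A] (u : X → A → ℝ) :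
    ∃ B, 0 ≤ B ∧ ∀ x a, |u x a| ≤ B := by
  obtain ⟨B, hB⟩ := (Set.finite_range fun ξ : X × A => |u ξ.1 ξ.2|).bddAbove
  exact ⟨max B 0, le_max_right _ _, fun x a => (hB ⟨(x, a), rfl⟩).trans (le_max_left _ _)⟩

theorem actor_chain_uniform_ergodicity
    {X A : Type*} [Fintype X] [Fintype A] [Nonempty X] [Nonempty A]
    [DecidableEq X] [DecidableEq A]
    (p : X → A → X → ℝ) (μ : X → ℝ) (r : X → A → ℝ) (γ α : ℝ)
    (hp0 : ∀ x a x', 0 ≤ p x a x') (hp1 : ∀ x a, ∑ x', p x a x' = 1)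
    (hμ0 : ∀ x, 0 ≤ μ x) (hμ1 : ∑ x, μ x = 1)
    (hr : ∀ x a, 0 ≤ r x a ∧ r x a ≤ 1) (hγ : 0 < γ ∧ γ < 1) (hα : 0 < α)
    (sigsta : (X → A → ℝ) → X × A → ℝ)
    (hsig : ∀ θ : X → A → ℝ,
      IsStationaryDist (actorKer γ p μ (softmaxPol θ)) (sigsta (softmaxPol θ)))
    (hsigLip : ∃ L : ℝ, ∀ f f' : X → A → ℝ,
      ∑ ξ : X × A, |sigsta f ξ - sigsta f' ξ| ≤ L * ∑ x, ∑ a, |f x a - f' x a|)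
    (hergA : ∀ θ : X → A → ℝ, ∃ n, 0 < n ∧
      ∀ ξ ξ' : X × A, 0 < kpow (actorKer γ p μ (softmaxPol θ)) n ξ ξ')
    (Q0 θ0 : X → A → ℝ) (T : ℝ) (hT : 0 < T) :
    ∃ n₀ : ℕ, 1 ≤ n₀ ∧ ∃ C : ℝ, 0 < C ∧ ∃ εT : ℝ, 0 < εT ∧
      ∃ βT : ℝ, 0 < βT ∧ βT < 1 ∧
      ∀ N : ℕ, 0 < N →
        ∀ (xc : ℕ → X) (ac : ℕ → A) (xa : ℕ → X) (aa : ℕ → A) (Q θ : ℕ → X → A → ℝ),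
        Q 0 = Q0 → θ 0 = θ0 →
        (∀ k x a, Q (k + 1) x a = Q k x a + (α / N) *
          (r (xc k) (ac k) + γ * (∑ a'', Q k (xc (k + 1)) a'' *
              explorePol (etaN N k) (θ k) (xc (k + 1)) a'') - Q k (xc k) (ac k)) *
          (if xc k = x ∧ ac k = a then 1 else 0)) →
        (∀ k x a, θ (k + 1) x a = θ k x a + (zetaN N k / N) *
          Q k (xa k) (aa k) * (if xa k = x then 1 else 0) *
          ((if aa k = a then 1 else 0) - softmaxPol (θ k) (xa k) a)) →
        ∀ k : ℕ, (k : ℝ) ≤ (N : ℝ) * T →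
          (∀ ξ : X × A, C * εT ^ n₀ ≤ sigsta (softmaxPol (θ k)) ξ) ∧
          (∀ (ξ : X × A) (n : ℕ),
            (1 / 2) * ∑ ξ' : X × A,
                |kpow (actorKer γ p μ (softmaxPol (θ k))) n ξ ξ' -
                  sigsta (softmaxPol (θ k)) ξ'|
              ≤ (1 - βT) ^ (n / n₀)) := by
  obtain ⟨BQ, hBQ0, hBQ⟩ := exists_abs_le Q0
  obtain ⟨Bθ, -, hBθ⟩ := exists_abs_le θ0
  obtain ⟨n₀, hn₀, hpos⟩ := hergA 0
  set D := (BQ + 1) * Real.exp (2 * α * T)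
  have hD0 : 0 ≤ D := by positivity
  set c := Real.exp (-(2 * (Bθ + D * T))) with hcdef
  have hc : 0 < c := Real.exp_pos _
  obtain ⟨ξ₀, hξ₀⟩ := Finite.exists_min fun ξ : (X × A) × (X × A) =>
    kpow (actorKer γ p μ (softmaxPol 0)) n₀ ξ.1 ξ.2
  set m := kpow (actorKer γ p μ (softmaxPol 0)) n₀ ξ₀.1 ξ₀.2
  have hm : 0 < m := hpos _ _
  have hker0 : ∀ (θ : X → A → ℝ) (ξ ξ' : X × A), 0 ≤ actorKer γ p μ (softmaxPol θ) ξ ξ' :=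
    fun θ ξ ξ' => mul_nonneg (ptilde_nonneg hp0 hμ0 hγ _ _ _) ((isPolicy_softmaxPol θ).1 _ _)
  refine ⟨n₀, hn₀, m, hm, c, hc, min (m * c ^ n₀) (1 / 2), by positivity,
    (min_le_right _ _).trans_lt (by norm_num), ?_⟩
  intro N hN xc ac xa aa Q θ hQ0 hθ0 hQ hθ k hk
  have hN' : (0 : ℝ) < N := by exact_mod_cast hN
  have hfrac : ∀ j ≤ k, (j : ℝ) / N ≤ T := fun j hj => by
    rw [div_le_iff₀' hN']
    exact le_trans (by exact_mod_cast hj) hk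
  have hQbd : ∀ j ≤ k, ∀ x a, |Q j x a| ≤ D := fun j hj x a => by
    have h := critic_add_one_le hr hγ hα hN hQ (B := BQ) (fun x a => hQ0 ▸ hBQ x a) j x a
    have h' : (BQ + 1) * Real.exp (2 * α * (j / N)) ≤ D := by
      refine mul_le_mul_of_nonneg_left (Real.exp_le_exp.2 ?_) (by positivity)
      exact mul_le_mul_of_nonneg_left (hfrac j hj) (by positivity)
    linarith
  have hθbd : ∀ x a, |θ k x a| ≤ Bθ + D * T := fun x a =>
    (actor_abs_le hN hθ (B := Bθ) (fun x a => hθ0 ▸ hBθ x a) hQbd k le_rfl x a).trans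
      (add_le_add_right (mul_le_mul_of_nonneg_left (hfrac k le_rfl) hD0) _)
  have hminor : ∀ ξ ξ', m * c ^ n₀ ≤ kpow (actorKer γ p μ (softmaxPol (θ k))) n₀ ξ ξ' := by
    intro ξ ξ'
    have hcmp : ∀ ξ ξ' : X × A, c * actorKer γ p μ (softmaxPol 0) ξ ξ' ≤
        actorKer γ p μ (softmaxPol (θ k)) ξ ξ' := fun ξ ξ' => by
      have := mul_le_mul_of_nonneg_left (exp_mul_softmaxPol_zero_le hθbd ξ'.1 ξ'.2)
        (ptilde_nonneg hp0 hμ0 hγ ξ.1 ξ.2 ξ'.1)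
      rw [← hcdef, mul_left_comm] at this
      exact this
    calc m * c ^ n₀ = c ^ n₀ * m := mul_comm _ _
      _ ≤ c ^ n₀ * kpow (actorKer γ p μ (softmaxPol 0)) n₀ ξ ξ' :=
        mul_le_mul_of_nonneg_left (hξ₀ (ξ, ξ')) (by positivity)
      _ ≤ _ := pow_mul_kpow_le hc.le (hker0 0) hcmp n₀ ξ ξ'
  have hstat := hsig (θ k)
  refine ⟨hstat.le_of_le_kpow hminor, hstat.tv_kpow_le (hker0 (θ k))
    (actorKer_sum hp1 hμ1 (isPolicy_softmaxPol (θ k))) fun ξ ξ' => ?_⟩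
  have hle1 : sigsta (softmaxPol (θ k)) ξ' ≤ 1 := by
    rw [← hstat.2.1]
    exact Finset.single_le_sum (fun y _ => hstat.1 y) (Finset.mem_univ ξ')
  calc min (m * c ^ n₀) (1 / 2) * sigsta (softmaxPol (θ k)) ξ'
      ≤ min (m * c ^ n₀) (1 / 2) := mul_le_of_le_one_right (by positivity) hle1
    _ ≤ _ := (min_le_left _ _).trans (hminor ξ ξ')
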